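/- Let {u_i}_{i=1}^n, {v_i}_{i=1}^n, {w_i}_{i=1}^n be orthonormal bases of ℝ^n, let r ≤ n, let Ω ⊆ [n]³, and let T ∈ (ℝ^n)^{⊗3} be a higher-degree certificate for Ω and {u_i}_{i≤r}, {v_i}_{i≤r}, {w_i}_{i≤r}. Then every degree-6 pseudo-distribution μ(x,y,z) over ℝ^n × ℝ^n × ℝ^n satisfying the constraint {‖y‖² = 1} obeys: pE_μ ⟨T, x⊗y⊗z⟩ ≤ pE_μ[ (‖x‖² + ‖z‖²)/2 − (1/100)·Σ_{i=r+1}^n (⟨u_i,x⟩² + ⟨w_i,z⟩²) − (1/100)·Σ_{i=1}^n Σ_{j ≠ i} ⟨v_i,y⟩²·(⟨u_j,x⟩² + ⟨w_j,z⟩²) ]. -/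

import Mathlib

open scoped BigOperators
open MvPolynomial

noncomputable section

/-- Points `(x, y, z) ∈ ℝ^n × ℝ^n × ℝ^n`. -/
abbrev Pt (n : ℕ) := (Fin n → ℝ) × (Fin n → ℝ) × (Fin n → ℝ)

/-- The pseudo-expectation of a function under a finitely supported `μ`. -/
def pE {n : ℕ} (μ : Pt n →₀ ℝ)
    (f : (Fin n → ℝ) → (Fin n → ℝ) → (Fin n → ℝ) → ℝ) : ℝ :=
  ∑ p ∈ μ.support, μ p * f p.1 p.2.1 p.2.2

/-- A degree-`d` pseudo-distribution over `ℝ^n × ℝ^n × ℝ^n`. -/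
def IsPseudoDist {n : ℕ} (d : ℕ) (μ : Pt n →₀ ℝ) : Prop :=
  (∑ p ∈ μ.support, μ p) = 1 ∧
  ∀ f : MvPolynomial (Fin n ⊕ Fin n ⊕ Fin n) ℝ, f.totalDegree ≤ d / 2 →
    0 ≤ ∑ p ∈ μ.support,
      μ p * (MvPolynomial.eval (Sum.elim p.1 (Sum.elim p.2.1 p.2.2)) f) ^ 2

/-- A degree-`ℓ` pseudo-distribution `μ(x,y,z)` satisfies the constraint `{‖y‖² = 1}`:
`pE_μ[p·(1 − ‖y‖²)] = 0` for all polynomials `p` of degree at most `ℓ − 2`. -/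
def SatisfiesYUnit {n : ℕ} (ℓ : ℕ) (μ : Pt n →₀ ℝ) : Prop :=
  ∀ f : MvPolynomial (Fin n ⊕ Fin n ⊕ Fin n) ℝ, f.totalDegree ≤ ℓ - 2 →
    (∑ p ∈ μ.support,
      μ p * (MvPolynomial.eval (Sum.elim p.1 (Sum.elim p.2.1 p.2.2)) f) *
        (1 - ∑ i, p.2.1 i ^ 2)) = 0

abbrev XVar {n : ℕ} (i : Fin n) : MvPolynomial (Fin n ⊕ Fin n ⊕ Fin n) ℝ :=
  X (Sum.inl i)
abbrev YVar {n : ℕ} (i : Fin n) : MvPolynomial (Fin n ⊕ Fin n ⊕ Fin n) ℝ :=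
  X (Sum.inr (Sum.inl i))
abbrev ZVar {n : ℕ} (i : Fin n) : MvPolynomial (Fin n ⊕ Fin n ⊕ Fin n) ℝ :=
  X (Sum.inr (Sum.inr i))

/-- `T` is a higher-degree certificate for `Ω` and the first `r` vectors of the
orthonormal bases `u`, `v`, `w`. -/
def IsHigherCert (n r : ℕ) (hr : r ≤ n) (u v w : Fin n → Fin n → ℝ)
    (Ω : Finset (Fin n × Fin n × Fin n)) (T : Fin n → Fin n → Fin n → ℝ) : Prop :=
  -- (1) linear independence of the restricted rank-one tensors
  LinearIndependent ℝ (fun i : Fin r => fun t : Fin n × Fin n × Fin n =>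
    if t ∈ Ω then
      u (Fin.castLE hr i) t.1 * v (Fin.castLE hr i) t.2.1 * w (Fin.castLE hr i) t.2.2
    else 0) ∧
  -- (2) T is supported on Ω
  (∀ a b c, (a, b, c) ∉ Ω → T a b c = 0) ∧
  -- (3) contraction conditions
  (∀ i : Fin r, ∀ c, (∑ a, ∑ b,
    T a b c * u (Fin.castLE hr i) a * v (Fin.castLE hr i) b) = w (Fin.castLE hr i) c) ∧
  (∀ i : Fin r, ∀ b, (∑ a, ∑ c,
    T a b c * u (Fin.castLE hr i) a * w (Fin.castLE hr i) c) = v (Fin.castLE hr i) b) ∧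
  (∀ i : Fin r, ∀ a, (∑ b, ∑ c,
    T a b c * v (Fin.castLE hr i) b * w (Fin.castLE hr i) c) = u (Fin.castLE hr i) a) ∧
  -- (4) sums-of-squares conditions with ε = 10⁻⁶ (so 1/ε = 10⁶),
  -- where T' = T − Σ_i u_i ⊗ v_i ⊗ w_i
  (let TP' : MvPolynomial (Fin n ⊕ Fin n ⊕ Fin n) ℝ :=
    ∑ a, ∑ b, ∑ c,
      C (T a b c - ∑ i : Fin r,
          u (Fin.castLE hr i) a * v (Fin.castLE hr i) b * w (Fin.castLE hr i) c) *
        XVar a * YVar b * ZVar c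
  IsSumSq ((∑ i, XVar i ^ 2) + (∑ i, YVar i ^ 2) * (∑ i, ZVar i ^ 2) -
      C (1000000 : ℝ) * TP') ∧
  IsSumSq ((∑ i, YVar i ^ 2) + (∑ i, XVar i ^ 2) * (∑ i, ZVar i ^ 2) -
      C (1000000 : ℝ) * TP') ∧
  IsSumSq ((∑ i, ZVar i ^ 2) + (∑ i, XVar i ^ 2) * (∑ i, YVar i ^ 2) -
      C (1000000 : ℝ) * TP'))


section SosDegree
variable {σ : Type*}

theorem deg_drop (m : ℕ) (f : MvPolynomial σ ℝ) (hf : f.totalDegree ≤ m + 1)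
    (h0 : homogeneousComponent (m + 1) f = 0) : f.totalDegree ≤ m := by
  unfold MvPolynomial.totalDegree
  refine Finset.sup_le ?_
  intro s hs
  have h1 := (le_totalDegree hs).trans hf
  by_contra h2
  have h3 : s.degree = m + 1 := by
    simp only [Finsupp.degree_apply, Finsupp.sum] at *
    omega
  have h4 := coeff_homogeneousComponent (m + 1) f s
  rw [h0, if_pos h3] at h4
  exact (mem_support_iff.mp hs) (by simpa using h4.symm)

theorem hc_sq (m : ℕ) (f : MvPolynomial σ ℝ) (hf : f.totalDegree ≤ m + 1) :
    homogeneousComponent (2 * (m + 1)) (f ^ 2) = (homogeneousComponent (m + 1) f) ^ 2 := by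
  set g := homogeneousComponent (m + 1) f with hg
  have hgh : g.IsHomogeneous (m + 1) := homogeneousComponent_isHomogeneous _ _
  have hgd : g.totalDegree ≤ m + 1 := hgh.totalDegree_le
  have hgg : homogeneousComponent (m + 1) g = g := homogeneousComponent_eq_self hgh
  have hd : (f - g).totalDegree ≤ m := by
    apply deg_drop
    · exact (totalDegree_sub _ _).trans (max_le hf hgd)
    · rw [map_sub, hgg, ← hg, sub_self]
  have e : f ^ 2 = g ^ 2 + (f - g) * (f + g) := by ring
  rw [e, map_add]
  have h1 : homogeneousComponent (2 * (m + 1)) (g ^ 2) = g ^ 2 := by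
    apply homogeneousComponent_eq_self
    have := hgh.pow 2
    rwa [mul_comm] at this
  have h2 : homogeneousComponent (2 * (m + 1)) ((f - g) * (f + g)) = 0 := by
    apply homogeneousComponent_eq_zero
    have := totalDegree_mul (f - g) (f + g)
    have := (totalDegree_add f g).trans (max_le hf hgd)
    omega
  rw [h1, h2, add_zero]

theorem sumsq_list_zero (l : List (MvPolynomial σ ℝ)) (h : (l.map (fun f => f ^ 2)).sum = 0) :
    ∀ f ∈ l, f = 0 := by
  intro f hf
  apply MvPolynomial.funext
  intro x
  have h1 : (l.map (fun f => (eval x f) ^ 2)).sum = 0 := by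
    have := congrArg (eval x) h
    rw [map_list_sum, List.map_map] at this
    simpa [Function.comp_def] using this
  have h2 : (eval x f) ^ 2 ≤ (l.map (fun f => (eval x f) ^ 2)).sum := by
    apply List.single_le_sum
    · intro y hy
      obtain ⟨g, _, rfl⟩ := List.mem_map.mp hy
      positivity
    · exact List.mem_map.mpr ⟨f, hf, rfl⟩
  rw [h1] at h2
  have := pow_eq_zero_iff (two_ne_zero) |>.mp (le_antisymm h2 (sq_nonneg _))
  simpa using this

theorem sos_deg_aux (d : ℕ) (l : List (MvPolynomial σ ℝ))
    (hQ : ((l.map (fun f => f ^ 2)).sum).totalDegree ≤ 2 * d) (k : ℕ)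
    (hk : ∀ f ∈ l, f.totalDegree ≤ d + k) : ∀ f ∈ l, f.totalDegree ≤ d := by
  induction k with
  | zero => exact hk
  | succ k ih =>
    apply ih
    have h0 : homogeneousComponent (2 * (d + k + 1)) ((l.map (fun f => f ^ 2)).sum) = 0 := by
      apply homogeneousComponent_eq_zero
      omega
    rw [map_list_sum, List.map_map] at h0
    have h1 : ((l.map (homogeneousComponent (d + k + 1))).map (fun f => f ^ 2)).sum = 0 := by
      rw [← h0, List.map_map]
      congr 1
      apply List.map_congr_left
      intro f hf
      exact (hc_sq (d + k) f (hk f hf)).symm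
    intro f hf
    apply deg_drop _ _ (hk f hf)
    exact sumsq_list_zero _ h1 _ (List.mem_map.mpr ⟨f, hf, rfl⟩)

theorem sos_deg (d : ℕ) (Q : MvPolynomial σ ℝ) (hs : IsSumSq Q) (hQ : Q.totalDegree ≤ 2 * d) :
    ∃ l : List (MvPolynomial σ ℝ), Q = (l.map (fun f => f ^ 2)).sum ∧
      ∀ f ∈ l, f.totalDegree ≤ d := by
  have h : ∃ l : List (MvPolynomial σ ℝ), Q = (l.map (fun f => f ^ 2)).sum := by
    clear hQ
    induction hs with
    | zero => exact ⟨[], by simp⟩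
    | sq_add a hs ih =>
      obtain ⟨l, rfl⟩ := ih
      exact ⟨a :: l, by simp [sq]⟩
  obtain ⟨l, rfl⟩ := h
  refine ⟨l, rfl, sos_deg_aux d l hQ ((l.map totalDegree).sum) ?_⟩
  intro f hf
  have : f.totalDegree ≤ (l.map totalDegree).sum :=
    List.single_le_sum (by simp) _ (List.mem_map.mpr ⟨f, hf, rfl⟩)
  omega

theorem totalDegree_aeval_le' {τ : Type*} (g : σ → MvPolynomial τ ℝ)
    (hg : ∀ i, (g i).totalDegree ≤ 1) (f : MvPolynomial σ ℝ) :
    (aeval g f).totalDegree ≤ f.totalDegree := by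
  conv_lhs => rw [f.as_sum]
  rw [map_sum]
  apply totalDegree_finsetSum_le
  intro s hs
  rw [aeval_monomial]
  refine (totalDegree_mul _ _).trans ?_
  have : (algebraMap ℝ (MvPolynomial τ ℝ) (coeff s f)).totalDegree = 0 := totalDegree_C _
  rw [this, zero_add]
  refine le_trans ?_ (le_totalDegree hs)
  refine (totalDegree_finsetProd _ _).trans ?_
  apply Finset.sum_le_sum
  intro i _
  refine (totalDegree_pow _ _).trans ?_
  have := hg i
  nlinarith
end SosDegree

section PolyFun
variable {n : ℕ}

/-- `f` is a polynomial function of degree at most `d`. -/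
def IsPF (d : ℕ) (f : Pt n → ℝ) : Prop :=
  ∃ q : MvPolynomial (Fin n ⊕ Fin n ⊕ Fin n) ℝ, q.totalDegree ≤ d ∧
    ∀ p : Pt n, f p = eval (Sum.elim p.1 (Sum.elim p.2.1 p.2.2)) q

theorem IsPF.mono {d e : ℕ} {f : Pt n → ℝ} (h : IsPF d f) (hde : d ≤ e) : IsPF e f := by
  obtain ⟨q, h1, h2⟩ := h
  exact ⟨q, h1.trans hde, h2⟩

theorem IsPF.const (d : ℕ) (c : ℝ) : IsPF d (fun _ : Pt n => c) :=
  ⟨C c, by simp, fun p => by simp⟩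

theorem IsPF.x (a : Fin n) : IsPF 1 (fun p : Pt n => p.1 a) :=
  ⟨XVar a, by simp, fun p => by simp⟩

theorem IsPF.y (a : Fin n) : IsPF 1 (fun p : Pt n => p.2.1 a) :=
  ⟨YVar a, by simp, fun p => by simp⟩

theorem IsPF.z (a : Fin n) : IsPF 1 (fun p : Pt n => p.2.2 a) :=
  ⟨ZVar a, by simp, fun p => by simp⟩

theorem IsPF.add {d : ℕ} {f g : Pt n → ℝ} (hf : IsPF d f) (hg : IsPF d g) :
    IsPF d (fun p => f p + g p) := by
  obtain ⟨q, h1, h2⟩ := hf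
  obtain ⟨q', h1', h2'⟩ := hg
  exact ⟨q + q', (totalDegree_add _ _).trans (max_le h1 h1'), fun p => by simp [h2, h2']⟩

theorem IsPF.sub {d : ℕ} {f g : Pt n → ℝ} (hf : IsPF d f) (hg : IsPF d g) :
    IsPF d (fun p => f p - g p) := by
  obtain ⟨q, h1, h2⟩ := hf
  obtain ⟨q', h1', h2'⟩ := hg
  exact ⟨q - q', (totalDegree_sub _ _).trans (max_le h1 h1'), fun p => by simp [h2, h2']⟩

theorem IsPF.mul {d e : ℕ} {f g : Pt n → ℝ} (hf : IsPF d f) (hg : IsPF e g) :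
    IsPF (d + e) (fun p => f p * g p) := by
  obtain ⟨q, h1, h2⟩ := hf
  obtain ⟨q', h1', h2'⟩ := hg
  exact ⟨q * q', (totalDegree_mul _ _).trans (add_le_add h1 h1'), fun p => by simp [h2, h2']⟩

theorem IsPF.sq {d : ℕ} {f : Pt n → ℝ} (hf : IsPF d f) :
    IsPF (d + d) (fun p => f p ^ 2) := by
  simpa [pow_two] using hf.mul hf

theorem IsPF.sum {ι : Type*} (s : Finset ι) {d : ℕ} {f : ι → Pt n → ℝ}
    (hf : ∀ i, IsPF d (f i)) : IsPF d (fun p => ∑ i ∈ s, f i p) := by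
  choose q h1 h2 using hf
  exact ⟨∑ i ∈ s, q i, totalDegree_finsetSum_le fun i _ => h1 i, fun p => by simp [h2]⟩

theorem IsPF.cmul {d : ℕ} {f : Pt n → ℝ} (c : ℝ) (hf : IsPF d f) :
    IsPF d (fun p => c * f p) := by
  simpa using (IsPF.const 0 c).mul hf

/-- The pseudo-expectation as a linear functional. -/
def EE (μ : Pt n →₀ ℝ) : (Pt n → ℝ) →ₗ[ℝ] ℝ where
  toFun f := ∑ p ∈ μ.support, μ p * f p
  map_add' f g := by simp [mul_add, Finset.sum_add_distrib]
  map_smul' c f := by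
    simp only [Pi.smul_apply, smul_eq_mul, RingHom.id_apply, Finset.mul_sum]
    exact Finset.sum_congr rfl fun p _ => by ring

theorem EE_sq {μ : Pt n →₀ ℝ} (hμ : IsPseudoDist 6 μ) {f : Pt n → ℝ} (hf : IsPF 3 f) :
    0 ≤ EE μ (fun p => f p ^ 2) := by
  obtain ⟨q, h1, h2⟩ := hf
  have := hμ.2 q (by simpa using h1)
  simpa [EE, h2] using this

theorem EE_unit {μ : Pt n →₀ ℝ} (hμ : SatisfiesYUnit 6 μ) {f : Pt n → ℝ} (hf : IsPF 4 f) :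
    EE μ (fun p => f p * ∑ i, p.2.1 i ^ 2) = EE μ f := by
  obtain ⟨q, h1, h2⟩ := hf
  have := hμ q (by simpa using h1)
  have e : EE μ (fun p => f p * (1 - ∑ i, p.2.1 i ^ 2)) = 0 := by
    rw [← this]
    simp [EE, h2, mul_assoc]
  have e2 : (fun p : Pt n => f p * (1 - ∑ i, p.2.1 i ^ 2)) =
      f - (fun p => f p * ∑ i, p.2.1 i ^ 2) := by
    funext p
    simp only [Pi.sub_apply]
    ring
  rw [e2, map_sub] at e
  linarith

theorem EE_sum {ι : Type*} (μ : Pt n →₀ ℝ) (s : Finset ι) (f : ι → Pt n → ℝ) :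
    EE μ (fun p => ∑ i ∈ s, f i p) = ∑ i ∈ s, EE μ (f i) := by
  rw [← map_sum]
  congr 1
  funext p
  simp

theorem EE_cmul (μ : Pt n →₀ ℝ) (c : ℝ) (f : Pt n → ℝ) :
    EE μ (fun p => c * f p) = c * EE μ f := by
  rw [← smul_eq_mul, ← map_smul]
  rfl

theorem EE_sos {μ : Pt n →₀ ℝ} (hμ : IsPseudoDist 6 μ)
    (Q : MvPolynomial (Fin n ⊕ Fin n ⊕ Fin n) ℝ) (hs : IsSumSq Q) (hQ : Q.totalDegree ≤ 4)
    (ℓ : Pt n → ℝ) (hℓ : IsPF 1 ℓ) (x y z : Pt n → Fin n → ℝ)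
    (hx : ∀ a, IsPF 1 (fun p => x p a)) (hy : ∀ a, IsPF 1 (fun p => y p a))
    (hz : ∀ a, IsPF 1 (fun p => z p a)) :
    0 ≤ EE μ (fun p => ℓ p ^ 2 * eval (Sum.elim (x p) (Sum.elim (y p) (z p))) Q) := by
  obtain ⟨l, rfl, hl⟩ := sos_deg 2 Q hs hQ
  clear hs hQ
  induction l with
  | nil => simp [EE]
  | cons f l ih =>
    have h1 := ih (fun g hg => hl g (List.mem_cons_of_mem _ hg))
    have hf := hl f List.mem_cons_self
    choose qx hx1 hx2 using hx
    choose qy hy1 hy2 using hy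
    choose qz hz1 hz2 using hz
    have hpf : IsPF 2 (fun p => eval (Sum.elim (x p) (Sum.elim (y p) (z p))) f) := by
      refine ⟨aeval (Sum.elim qx (Sum.elim qy qz)) f,
        (totalDegree_aeval_le' _ ?_ f).trans hf, ?_⟩
      · rintro (i | i | i)
        · exact hx1 i
        · exact hy1 i
        · exact hz1 i
      · intro p
        beta_reduce
        rw [← MvPolynomial.coe_aeval_eq_eval, ← MvPolynomial.coe_aeval_eq_eval]
        simp only [RingHom.coe_coe]
        rw [MvPolynomial.comp_aeval_apply
          (φ := aeval (R := ℝ) (Sum.elim p.1 (Sum.elim p.2.1 p.2.2)))]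
        congr 1
        congr 1
        funext i
        rcases i with i | i | i
        · simp [hx2]
        · simp [hy2]
        · simp [hz2]
    have h2 := EE_sq hμ (hℓ.mul hpf)
    have e : (fun p => ℓ p ^ 2 * eval (Sum.elim (x p) (Sum.elim (y p) (z p)))
        ((f :: l).map (fun f => f ^ 2)).sum) =
        (fun p => (ℓ p * eval (Sum.elim (x p) (Sum.elim (y p) (z p))) f) ^ 2) +
        (fun p => ℓ p ^ 2 * eval (Sum.elim (x p) (Sum.elim (y p) (z p)))
        (l.map (fun f => f ^ 2)).sum) := by
      funext p
      simp only [List.map_cons, List.sum_cons, map_add, map_pow, Pi.add_apply]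
      ring
    rw [e, map_add]
    exact add_nonneg h2 h1
end PolyFun

/-- Trilinear form. -/
def TF {n : ℕ} (T : Fin n → Fin n → Fin n → ℝ) (x y z : Fin n → ℝ) : ℝ :=
  ∑ a, ∑ b, ∑ c, T a b c * x a * y b * z c

section TFs
variable {n : ℕ} (T : Fin n → Fin n → Fin n → ℝ) (x x' y y' z z' : Fin n → ℝ) (c : ℝ)

theorem TF_x : TF T (x + c • x') y z = TF T x y z + c * TF T x' y z := by
  simp only [TF, Finset.mul_sum, ← Finset.sum_add_distrib, Pi.add_apply, Pi.smul_apply,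
    smul_eq_mul]
  refine Finset.sum_congr rfl fun a _ => Finset.sum_congr rfl fun b _ =>
    Finset.sum_congr rfl fun c _ => by ring

theorem TF_y : TF T x (y + c • y') z = TF T x y z + c * TF T x y' z := by
  simp only [TF, Finset.mul_sum, ← Finset.sum_add_distrib, Pi.add_apply, Pi.smul_apply,
    smul_eq_mul]
  refine Finset.sum_congr rfl fun a _ => Finset.sum_congr rfl fun b _ =>
    Finset.sum_congr rfl fun c _ => by ring

theorem TF_z : TF T x y (z + c • z') = TF T x y z + c * TF T x y z' := by
  simp only [TF, Finset.mul_sum, ← Finset.sum_add_distrib, Pi.add_apply, Pi.smul_apply,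
    smul_eq_mul]
  refine Finset.sum_congr rfl fun a _ => Finset.sum_congr rfl fun b _ =>
    Finset.sum_congr rfl fun c _ => by ring

theorem TF_smul_x : TF T (c • x) y z = c * TF T x y z := by
  simp only [TF, Finset.mul_sum, Pi.smul_apply, smul_eq_mul]
  refine Finset.sum_congr rfl fun a _ => Finset.sum_congr rfl fun b _ =>
    Finset.sum_congr rfl fun c _ => by ring

theorem TF_smul_z : TF T x y (c • z) = c * TF T x y z := by
  simp only [TF, Finset.mul_sum, Pi.smul_apply, smul_eq_mul]
  refine Finset.sum_congr rfl fun a _ => Finset.sum_congr rfl fun b _ =>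
    Finset.sum_congr rfl fun c _ => by ring

theorem TF_rot1 : TF T x y z = ∑ c, (∑ a, ∑ b, T a b c * x a * y b) * z c := by
  simp only [TF, Finset.sum_mul]
  rw [Finset.sum_comm' (t' := Finset.univ) (s' := fun _ => Finset.univ) (by simp)]
  rw [Finset.sum_comm]
  rw [Finset.sum_congr rfl (fun a _ => Finset.sum_comm)]
  rw [Finset.sum_comm]

theorem TF_rot2 : TF T x y z = ∑ b, (∑ a, ∑ c, T a b c * x a * z c) * y b := by
  simp only [TF, Finset.sum_mul]
  rw [Finset.sum_comm]
  refine Finset.sum_congr rfl fun a _ => Finset.sum_congr rfl fun b _ =>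
    Finset.sum_congr rfl fun c _ => by ring

theorem TF_rot3 : TF T x y z = ∑ a, (∑ b, ∑ c, T a b c * y b * z c) * x a := by
  simp only [TF, Finset.sum_mul]
  refine Finset.sum_congr rfl fun a _ => Finset.sum_congr rfl fun b _ =>
    Finset.sum_congr rfl fun c _ => by ring

theorem TF_sub (T' : Fin n → Fin n → Fin n → ℝ) :
    TF (fun a b c => T a b c - T' a b c) x y z = TF T x y z - TF T' x y z := by
  simp only [TF, ← Finset.sum_sub_distrib]
  refine Finset.sum_congr rfl fun a _ => Finset.sum_congr rfl fun b _ =>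
    Finset.sum_congr rfl fun c _ => by ring

theorem TF_rank {ι : Type*} (s : Finset ι) (u v w : ι → Fin n → ℝ) :
    TF (fun a b c => ∑ i ∈ s, u i a * v i b * w i c) x y z =
      ∑ i ∈ s, (∑ a, u i a * x a) * (∑ b, v i b * y b) * (∑ c, w i c * z c) := by
  classical
  induction s using Finset.induction_on with
  | empty => simp [TF]
  | insert i s hi ih =>
    rw [Finset.sum_insert hi, ← ih]
    have h1 : (∑ a, u i a * x a) * (∑ b, v i b * y b) * (∑ c, w i c * z c) =
        TF (fun a b c => u i a * v i b * w i c) x y z := by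
      rw [Finset.sum_mul_sum, Finset.sum_mul, TF]
      refine Finset.sum_congr rfl fun a _ => ?_
      rw [Finset.sum_mul]
      refine Finset.sum_congr rfl fun b _ => ?_
      rw [Finset.mul_sum]
      exact Finset.sum_congr rfl fun c _ => by ring
    rw [h1]
    simp only [TF, Finset.sum_insert hi, ← Finset.sum_add_distrib]
    refine Finset.sum_congr rfl fun a _ => Finset.sum_congr rfl fun b _ =>
      Finset.sum_congr rfl fun c _ => by ring
end TFs

theorem parseval {n : ℕ} (u : Fin n → Fin n → ℝ)
    (hu : ∀ i j, (∑ a, u i a * u j a) = if i = j then (1 : ℝ) else 0) (x : Fin n → ℝ) :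
    ∑ i, (∑ a, u i a * x a) ^ 2 = ∑ a, x a ^ 2 := by
  have h1 : (Matrix.of u) * (Matrix.of u).transpose = 1 := by
    ext i j
    simp [Matrix.mul_apply, hu, Matrix.one_apply]
  have h2 := mul_eq_one_comm.mp h1
  have h3 : (Matrix.of u).mulVec x ⬝ᵥ (Matrix.of u).mulVec x = x ⬝ᵥ x := by
    rw [Matrix.dotProduct_mulVec, ← Matrix.mulVec_transpose, Matrix.mulVec_mulVec, h2,
      Matrix.one_mulVec]
  simpa [dotProduct, Matrix.mulVec, pow_two] using h3

theorem perp_norm {n : ℕ} (u x : Fin n → ℝ) (hu : ∑ a, u a * u a = 1) :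
    ∑ a, ((x - (∑ b, u b * x b) • u) a) ^ 2 = ∑ a, x a ^ 2 - (∑ b, u b * x b) ^ 2 := by
  set t := ∑ b, u b * x b with ht
  have : ∀ a, ((x - t • u) a) ^ 2 = x a ^ 2 - 2 * t * (u a * x a) + t ^ 2 * (u a * u a) := by
    intro a
    simp only [Pi.sub_apply, Pi.smul_apply, smul_eq_mul]
    ring
  simp only [this, Finset.sum_add_distrib, Finset.sum_sub_distrib, ← Finset.mul_sum, hu, ← ht]
  ring

theorem smul_norm {n : ℕ} (u : Fin n → ℝ) (hu : ∑ a, u a * u a = 1) (c : ℝ) :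
    ∑ a, ((c • u) a) ^ 2 = c ^ 2 := by
  have : ∀ a, ((c • u) a) ^ 2 = c ^ 2 * (u a * u a) := by
    intro a
    simp only [Pi.smul_apply, smul_eq_mul]
    ring
  simp only [this, ← Finset.mul_sum, hu, mul_one]

theorem TF_split {n : ℕ} (T : Fin n → Fin n → Fin n → ℝ) (u v w : Fin n → ℝ)
    (h1 : ∀ z, TF T u v z = 0) (h2 : ∀ y, TF T u y w = 0) (h3 : ∀ x, TF T x v w = 0)
    (x y z : Fin n → ℝ) (s t q : ℝ) :
    TF T x y z = TF T (x - s • u) y (z - q • w) + TF T (s • u) (y - t • v) (z - q • w)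
      + TF T (x - s • u) (y - t • v) (q • w) := by
  have ex : x = (x - s • u) + s • u := by simp
  have ey : y = (y - t • v) + t • v := by simp
  have ez : z = (z - q • w) + q • w := by simp
  generalize x - s • u = x' at *
  generalize y - t • v = y' at *
  generalize z - q • w = z' at *
  subst ex ey ez
  simp only [TF_x, TF_y, TF_z, TF_smul_x, TF_smul_z, h1, h2, h3]
  ring

theorem stepA {n : ℕ} (E : (Pt n → ℝ) →ₗ[ℝ] ℝ) (A B Y x y z t t1 t2 t3 : Pt n → ℝ)
    (ht : t = t1 + t2 + t3)
    (h1 : 0 ≤ E (y ^ 2 * ((A - x ^ 2) + Y * (B - z ^ 2) - t1)))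
    (h2 : 0 ≤ E (y ^ 2 * ((B - z ^ 2) + x ^ 2 * (Y - y ^ 2) - t2)))
    (h3 : 0 ≤ E (y ^ 2 * ((A - x ^ 2) + (Y - y ^ 2) * z ^ 2 - t3)))
    (h4 : E (y ^ 2 * (B - z ^ 2) * Y) = E (y ^ 2 * (B - z ^ 2)))
    (h5 : 0 ≤ E ((x * (Y - y ^ 2)) ^ 2)) (h5' : 0 ≤ E ((z * (Y - y ^ 2)) ^ 2))
    (h6 : E ((x ^ 2 + z ^ 2) * (Y - y ^ 2) * Y) = E ((x ^ 2 + z ^ 2) * (Y - y ^ 2))) :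
    E (y ^ 2 * t) ≤ 2 * E (y ^ 2 * (A + B - (x ^ 2 + z ^ 2)))
      + E ((x ^ 2 + z ^ 2) * (Y - y ^ 2)) := by
  have e : y ^ 2 * t = y ^ 2 * (A + B - (x ^ 2 + z ^ 2)) + y ^ 2 * (A + B - (x ^ 2 + z ^ 2))
      - (y ^ 2 * ((A - x ^ 2) + Y * (B - z ^ 2) - t1)
        + y ^ 2 * ((B - z ^ 2) + x ^ 2 * (Y - y ^ 2) - t2)
        + y ^ 2 * ((A - x ^ 2) + (Y - y ^ 2) * z ^ 2 - t3))
      + (y ^ 2 * (B - z ^ 2) * Y - y ^ 2 * (B - z ^ 2))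
      - ((x * (Y - y ^ 2)) ^ 2 + (z * (Y - y ^ 2)) ^ 2)
      + (x ^ 2 + z ^ 2) * (Y - y ^ 2) * Y := by
    rw [ht]
    ring
  rw [e]
  simp only [map_add, map_sub]
  linarith

theorem stepB {n : ℕ} (E : (Pt n → ℝ) →ₗ[ℝ] ℝ) (A B Y x y z t : Pt n → ℝ)
    (h1 : 0 ≤ E (y ^ 2 * (A + Y * B - t)))
    (h2 : E (y ^ 2 * B * Y) = E (y ^ 2 * B))
    (h3 : E ((x ^ 2 + z ^ 2) * Y) = E (x ^ 2 + z ^ 2))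
    (h4 : 0 ≤ E (y ^ 2 * (A + B - (x ^ 2 + z ^ 2))))
    (h5 : 0 ≤ E ((x ^ 2 + z ^ 2) * (Y - y ^ 2))) :
    E (y ^ 2 * t) ≤ 2 * E (y ^ 2 * (A + B - (x ^ 2 + z ^ 2)))
      + E ((x ^ 2 + z ^ 2) * (Y - y ^ 2)) + E (x ^ 2 + z ^ 2) := by
  have e : y ^ 2 * t = y ^ 2 * (A + B - (x ^ 2 + z ^ 2)) + (x ^ 2 + z ^ 2) * Y
      - (x ^ 2 + z ^ 2) * (Y - y ^ 2)
      - y ^ 2 * (A + Y * B - t) + (y ^ 2 * B * Y - y ^ 2 * B) := by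
    ring
  rw [e]
  simp only [map_add, map_sub] at *
  linarith

theorem stepC {n : ℕ} (E : (Pt n → ℝ) →ₗ[ℝ] ℝ) (x y z : Pt n → ℝ)
    (h1 : 0 ≤ E ((x - y * z) ^ 2)) (h2 : 0 ≤ E ((z - y * x) ^ 2)) :
    4 * E (x * y * z) ≤ E (x ^ 2 + z ^ 2) + E (y ^ 2 * (x ^ 2 + z ^ 2)) := by
  have e : (x ^ 2 + z ^ 2) + y ^ 2 * (x ^ 2 + z ^ 2) = (x - y * z) ^ 2 + (z - y * x) ^ 2 +
      (x * y * z + x * y * z + x * y * z + x * y * z) := by ring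
  rw [← map_add, e]
  simp only [map_add]
  linarith

theorem sum_castLE {n r : ℕ} (hr : r ≤ n) (g : Fin n → ℝ) :
    ∑ i : Fin r, g (Fin.castLE hr i) = ∑ i : Fin n, if r ≤ (i : ℕ) then 0 else g i := by
  have e : (∑ i : Fin n, if r ≤ (i : ℕ) then 0 else g i) =
      ∑ i : Fin n, if ¬ r ≤ (i : ℕ) then g i else 0 := by simp only [ite_not]
  rw [e, ← Finset.sum_filter]
  change ∑ i : Fin r, g (Fin.castLEEmb hr i) = _
  rw [← Finset.sum_map Finset.univ (Fin.castLEEmb hr) g]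
  congr 1
  ext i
  simp only [Finset.mem_map, Finset.mem_univ, true_and, Finset.mem_filter, Fin.castLEEmb_apply]
  constructor
  · rintro ⟨j, rfl⟩
    simp
  · intro h
    exact ⟨⟨i, by omega⟩, by ext; simp⟩

theorem final_arith {n r : ℕ} (a b c d e t : Fin n → ℝ)
    (hcd : ∀ i, 4 * d i ≤ c i + e i) (he : ∀ i, 0 ≤ e i) (ha : ∀ i, 0 ≤ a i)
    (hc : ∀ i, 0 ≤ c i)
    (hab : ∑ i, a i = ∑ i, b i) (hac : ∑ i, a i = ∑ i, c i - ∑ i, e i)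
    (ht : ∀ i : Fin n, t i ≤ 2 * a i + b i + if r ≤ (i : ℕ) then c i else 0) :
    (∑ i : Fin n, if r ≤ (i : ℕ) then 0 else d i) + (∑ i, t i) / 1000000 ≤
      (∑ i, c i) / 2 - (1 / 100) * (∑ i : Fin n, if r ≤ (i : ℕ) then c i else 0)
        - (1 / 100) * ∑ i, a i := by
  have h1 : ∑ i, t i ≤ 2 * ∑ i, a i + ∑ i, b i + ∑ i : Fin n, if r ≤ (i : ℕ) then c i else 0 := by
    rw [Finset.mul_sum, ← Finset.sum_add_distrib, ← Finset.sum_add_distrib]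
    exact Finset.sum_le_sum fun i _ => ht i
  have h2 : 4 * (∑ i : Fin n, if r ≤ (i : ℕ) then 0 else d i) +
      (∑ i : Fin n, if r ≤ (i : ℕ) then c i else 0) ≤ ∑ i, c i + ∑ i, e i := by
    rw [Finset.mul_sum, ← Finset.sum_add_distrib, ← Finset.sum_add_distrib]
    refine Finset.sum_le_sum fun i _ => ?_
    have := hcd i
    have := he i
    split_ifs <;> linarith
  have h3 : 0 ≤ ∑ i, a i := Finset.sum_nonneg fun i _ => ha i
  have h4 : 0 ≤ (∑ i : Fin n, if r ≤ (i : ℕ) then c i else 0) :=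
    Finset.sum_nonneg fun i _ => by split_ifs; exacts [hc i, le_rfl]
  linarith

theorem core {n r : ℕ} (u v w : Fin n → Fin n → ℝ)
    (hu : ∀ i j, (∑ a, u i a * u j a) = if i = j then (1 : ℝ) else 0)
    (hv : ∀ i j, (∑ a, v i a * v j a) = if i = j then (1 : ℝ) else 0)
    (hw : ∀ i j, (∑ a, w i a * w j a) = if i = j then (1 : ℝ) else 0)
    (S : Fin n → Fin n → Fin n → ℝ)
    (hS1 : ∀ i : Fin n, ¬ r ≤ (i : ℕ) → ∀ z, TF S (u i) (v i) z = 0)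
    (hS2 : ∀ i : Fin n, ¬ r ≤ (i : ℕ) → ∀ y, TF S (u i) y (w i) = 0)
    (hS3 : ∀ i : Fin n, ¬ r ≤ (i : ℕ) → ∀ x, TF S x (v i) (w i) = 0)
    (μ : Pt n →₀ ℝ) (hμ : IsPseudoDist 6 μ) (hμy : SatisfiesYUnit 6 μ)
    (hQ1 : ∀ (ℓ : Pt n → ℝ), IsPF 1 ℓ → ∀ (x y z : Pt n → Fin n → ℝ),
      (∀ a, IsPF 1 (fun p => x p a)) → (∀ a, IsPF 1 (fun p => y p a)) →
      (∀ a, IsPF 1 (fun p => z p a)) → 0 ≤ EE μ (fun p => ℓ p ^ 2 *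
        (∑ a, x p a ^ 2 + (∑ a, y p a ^ 2) * (∑ a, z p a ^ 2)
          - 1000000 * TF S (x p) (y p) (z p))))
    (hQ3 : ∀ (ℓ : Pt n → ℝ), IsPF 1 ℓ → ∀ (x y z : Pt n → Fin n → ℝ),
      (∀ a, IsPF 1 (fun p => x p a)) → (∀ a, IsPF 1 (fun p => y p a)) →
      (∀ a, IsPF 1 (fun p => z p a)) → 0 ≤ EE μ (fun p => ℓ p ^ 2 *
        (∑ a, z p a ^ 2 + (∑ a, x p a ^ 2) * (∑ a, y p a ^ 2)
          - 1000000 * TF S (x p) (y p) (z p)))) :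
    EE μ (fun p => (∑ i : Fin n, if r ≤ (i : ℕ) then 0 else
        (∑ a, u i a * p.1 a) * (∑ a, v i a * p.2.1 a) * (∑ a, w i a * p.2.2 a))
        + TF S p.1 p.2.1 p.2.2) ≤
      EE μ (fun p => ((∑ a, p.1 a ^ 2) + (∑ a, p.2.2 a ^ 2)) / 2
          - (1 / 100 : ℝ) * (∑ i ∈ Finset.univ.filter (fun i : Fin n => r ≤ (i : ℕ)),
              ((∑ a, u i a * p.1 a) ^ 2 + (∑ a, w i a * p.2.2 a) ^ 2))
          - (1 / 100 : ℝ) * (∑ i : Fin n, ∑ j ∈ Finset.univ.erase i,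
              (∑ a, v i a * p.2.1 a) ^ 2 *
                ((∑ a, u j a * p.1 a) ^ 2 + (∑ a, w j a * p.2.2 a) ^ 2))) := by
  have hu1 : ∀ i, ∑ a, u i a * u i a = 1 := fun i => by simp [hu]
  have hv1 : ∀ i, ∑ a, v i a * v i a = 1 := fun i => by simp [hv]
  have hw1 : ∀ i, ∑ a, w i a * w i a = 1 := fun i => by simp [hw]
  obtain ⟨x, hx⟩ : ∃ x : Fin n → Pt n → ℝ, x = fun i p => ∑ a, u i a * p.1 a := ⟨_, rfl⟩
  obtain ⟨y, hy⟩ : ∃ y : Fin n → Pt n → ℝ, y = fun i p => ∑ a, v i a * p.2.1 a := ⟨_, rfl⟩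
  obtain ⟨z, hz⟩ : ∃ z : Fin n → Pt n → ℝ, z = fun i p => ∑ a, w i a * p.2.2 a := ⟨_, rfl⟩
  obtain ⟨A, hA⟩ : ∃ A : Pt n → ℝ, A = fun p => ∑ a, p.1 a ^ 2 := ⟨_, rfl⟩
  obtain ⟨Y, hY⟩ : ∃ Y : Pt n → ℝ, Y = fun p => ∑ a, p.2.1 a ^ 2 := ⟨_, rfl⟩
  obtain ⟨B, hB⟩ : ∃ B : Pt n → ℝ, B = fun p => ∑ a, p.2.2 a ^ 2 := ⟨_, rfl⟩
  obtain ⟨t, ht⟩ : ∃ t : Pt n → ℝ, t = fun p => 1000000 * TF S p.1 p.2.1 p.2.2 := ⟨_, rfl⟩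
  have px : ∀ i, IsPF 1 (x i) := fun i => by
    rw [hx]; exact IsPF.sum _ fun a => (IsPF.x a).cmul _
  have py : ∀ i, IsPF 1 (y i) := fun i => by
    rw [hy]; exact IsPF.sum _ fun a => (IsPF.y a).cmul _
  have pz : ∀ i, IsPF 1 (z i) := fun i => by
    rw [hz]; exact IsPF.sum _ fun a => (IsPF.z a).cmul _
  have pA : IsPF 2 A := by rw [hA]; exact IsPF.sum _ fun a => (IsPF.x a).sq
  have pB : IsPF 2 B := by rw [hB]; exact IsPF.sum _ fun a => (IsPF.z a).sq
  have pY : IsPF 2 Y := by rw [hY]; exact IsPF.sum _ fun a => (IsPF.y a).sq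
  have pt : IsPF 3 t := by
    rw [ht]
    refine IsPF.cmul _ ?_
    exact IsPF.sum _ fun a => IsPF.sum _ fun b => IsPF.sum _ fun c =>
      ((((IsPF.x a).cmul _).mul (IsPF.y b)).mul (IsPF.z c))
  have sA : A = ∑ i, x i ^ 2 := by
    rw [hA, hx]; funext p
    simp [parseval u hu]
  have sB : B = ∑ i, z i ^ 2 := by
    rw [hB, hz]; funext p
    simp [parseval w hw]
  have sY : Y = ∑ i, y i ^ 2 := by
    rw [hY, hy]; funext p
    simp [parseval v hv]
  have unit : ∀ f, IsPF 4 f → EE μ (f * Y) = EE μ f := by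
    intro f hf
    rw [hY]
    exact EE_unit hμy hf
  have sq : ∀ f, IsPF 3 f → 0 ≤ EE μ (f ^ 2) := fun f hf => EE_sq hμ hf
  have ph : ∀ i, IsPF 2 (x i ^ 2 + z i ^ 2) := fun i => (px i).sq.add (pz i).sq
  have sqmul : ∀ f g, IsPF 1 f → IsPF 1 g → 0 ≤ EE μ (f ^ 2 * g ^ 2) := by
    intro f g hf hg
    rw [← mul_pow]
    exact sq _ ((hf.mul hg).mono (by norm_num))
  have hc : ∀ i, 0 ≤ EE μ (x i ^ 2 + z i ^ 2) := by
    intro i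
    rw [map_add]
    exact add_nonneg (sq _ ((px i).mono (by norm_num))) (sq _ ((pz i).mono (by norm_num)))
  have hyh : ∀ i j, 0 ≤ EE μ (y i ^ 2 * (x j ^ 2 + z j ^ 2)) := by
    intro i j
    rw [mul_add, map_add]
    exact add_nonneg (sqmul _ _ (py i) (px j)) (sqmul _ _ (py i) (pz j))
  have hH : A + B = ∑ i, (x i ^ 2 + z i ^ 2) := by
    rw [sA, sB, Finset.sum_add_distrib]
  have ea : ∀ i, y i ^ 2 * (A + B - (x i ^ 2 + z i ^ 2)) =
      ∑ j ∈ Finset.univ.erase i, y i ^ 2 * (x j ^ 2 + z j ^ 2) := by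
    intro i
    rw [hH, ← Finset.mul_sum, Finset.sum_erase_eq_sub (Finset.mem_univ i)]
  have eb : ∀ i, (x i ^ 2 + z i ^ 2) * (Y - y i ^ 2) =
      ∑ j ∈ Finset.univ.erase i, y j ^ 2 * (x i ^ 2 + z i ^ 2) := by
    intro i
    rw [sY, ← Finset.sum_mul, Finset.sum_erase_eq_sub (Finset.mem_univ i), mul_comm]
  have ha : ∀ i, 0 ≤ EE μ (y i ^ 2 * (A + B - (x i ^ 2 + z i ^ 2))) := by
    intro i
    rw [ea, map_sum]
    exact Finset.sum_nonneg fun j _ => hyh i j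
  have hb : ∀ i, 0 ≤ EE μ ((x i ^ 2 + z i ^ 2) * (Y - y i ^ 2)) := by
    intro i
    rw [eb, map_sum]
    exact Finset.sum_nonneg fun j _ => hyh j i
  have key := final_arith (n := n) (r := r)
    (fun i => EE μ (y i ^ 2 * (A + B - (x i ^ 2 + z i ^ 2))))
    (fun i => EE μ ((x i ^ 2 + z i ^ 2) * (Y - y i ^ 2)))
    (fun i => EE μ (x i ^ 2 + z i ^ 2))
    (fun i => EE μ (x i * y i * z i))
    (fun i => EE μ (y i ^ 2 * (x i ^ 2 + z i ^ 2)))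
    (fun i => EE μ (y i ^ 2 * t))
    (fun i => stepC _ _ _ _
      (sq _ ((((px i).mono (by norm_num : 1 ≤ 2)).sub ((py i).mul (pz i))).mono (by norm_num)))
      (sq _ ((((pz i).mono (by norm_num : 1 ≤ 2)).sub ((py i).mul (px i))).mono (by norm_num))))
    (fun i => hyh i i) ha hc
    (by
      rw [← map_sum, ← map_sum]
      congr 1
      simp only [mul_sub, Finset.sum_sub_distrib, ← Finset.sum_mul]
      rw [← sY, ← hH]
      congr 1
      · ring
      · exact Finset.sum_congr rfl fun i _ => by ring)
    (by
      rw [← map_sum, ← map_sum, ← map_sum, ← hH, ← unit (A + B) ((pA.add pB).mono (by norm_num)),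
        ← map_sub]
      congr 1
      simp only [mul_sub, Finset.sum_sub_distrib, ← Finset.sum_mul]
      rw [← sY]
      ring)
    (by
      intro j
      have pyj2 : IsPF 2 (y j ^ 2) := (py j).sq
      split_ifs with hj
      · refine stepB (EE μ) A B Y (x j) (y j) (z j) t ?_ ?_ ?_ (ha j) (hb j)
        · rw [hA, hB, hY, ht]
          exact hQ1 (y j) (py j) (fun p => p.1) (fun p => p.2.1) (fun p => p.2.2)
            IsPF.x IsPF.y IsPF.z
        · exact unit _ (pyj2.mul pB)
        · exact unit _ ((ph j).mono (by norm_num))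
      · rw [add_zero]
        have pxp : ∀ a, IsPF 1 (fun p : Pt n => (p.1 - x j p • u j) a) := fun a =>
          (IsPF.x a).sub ((px j).mul (IsPF.const 0 (u j a)))
        have pyp : ∀ a, IsPF 1 (fun p : Pt n => (p.2.1 - y j p • v j) a) := fun a =>
          (IsPF.y a).sub ((py j).mul (IsPF.const 0 (v j a)))
        have pzp : ∀ a, IsPF 1 (fun p : Pt n => (p.2.2 - z j p • w j) a) := fun a =>
          (IsPF.z a).sub ((pz j).mul (IsPF.const 0 (w j a)))
        have pxq : ∀ a, IsPF 1 (fun p : Pt n => (x j p • u j) a) := fun a =>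
          ((px j).mul (IsPF.const 0 (u j a)))
        have pzq : ∀ a, IsPF 1 (fun p : Pt n => (z j p • w j) a) := fun a =>
          ((pz j).mul (IsPF.const 0 (w j a)))
        have nx : ∀ p : Pt n, ∑ a, ((p.1 - x j p • u j) a) ^ 2 = A p - x j p ^ 2 := by
          intro p; rw [hx, hA]; exact perp_norm _ _ (hu1 j)
        have ny : ∀ p : Pt n, ∑ a, ((p.2.1 - y j p • v j) a) ^ 2 = Y p - y j p ^ 2 := by
          intro p; rw [hy, hY]; exact perp_norm _ _ (hv1 j)
        have nz : ∀ p : Pt n, ∑ a, ((p.2.2 - z j p • w j) a) ^ 2 = B p - z j p ^ 2 := by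
          intro p; rw [hz, hB]; exact perp_norm _ _ (hw1 j)
        have nxq : ∀ p : Pt n, ∑ a, ((x j p • u j) a) ^ 2 = x j p ^ 2 := fun p =>
          smul_norm _ (hu1 j) _
        have nzq : ∀ p : Pt n, ∑ a, ((z j p • w j) a) ^ 2 = z j p ^ 2 := fun p =>
          smul_norm _ (hw1 j) _
        have nY : ∀ p : Pt n, ∑ a, p.2.1 a ^ 2 = Y p := fun p => by rw [hY]
        have g1 := hQ1 (y j) (py j) (fun p => p.1 - x j p • u j) (fun p => p.2.1)
          (fun p => p.2.2 - z j p • w j) pxp IsPF.y pzp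
        have g2 := hQ3 (y j) (py j) (fun p => x j p • u j) (fun p => p.2.1 - y j p • v j)
          (fun p => p.2.2 - z j p • w j) pxq pyp pzp
        have g3 := hQ1 (y j) (py j) (fun p => p.1 - x j p • u j) (fun p => p.2.1 - y j p • v j)
          (fun p => z j p • w j) pxp pyp pzq
        simp only [nx, ny, nz, nxq, nzq, nY] at g1 g2 g3
        refine stepA (EE μ) A B Y (x j) (y j) (z j) t _ _ _ ?_ g1 g2 g3 ?_ ?_ ?_ ?_
        · rw [ht]
          funext p
          simp only [Pi.add_apply]
          rw [TF_split S (u j) (v j) (w j) (hS1 j hj) (hS2 j hj) (hS3 j hj) p.1 p.2.1 p.2.2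
            (x j p) (y j p) (z j p)]
          ring
        · exact unit _ (pyj2.mul (pB.sub (pz j).sq))
        · exact sq _ ((px j).mul (pY.sub (py j).sq))
        · exact sq _ ((pz j).mul (pY.sub (py j).sq))
        · exact unit _ ((ph j).mul (pY.sub (py j).sq)))
  have et : ∑ i, EE μ (y i ^ 2 * t) = 1000000 * EE μ (fun p => TF S p.1 p.2.1 p.2.2) := by
    rw [← map_sum, ← Finset.sum_mul, ← sY, mul_comm, unit t (pt.mono (by norm_num)), ht, EE_cmul]
  rw [et] at key
  have eL : (fun p : Pt n => (∑ i : Fin n, if r ≤ (i : ℕ) then 0 else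
        (∑ a, u i a * p.1 a) * (∑ a, v i a * p.2.1 a) * (∑ a, w i a * p.2.2 a))
        + TF S p.1 p.2.1 p.2.2) = (∑ i : Fin n, if r ≤ (i : ℕ) then 0 else x i * y i * z i)
        + (fun p => TF S p.1 p.2.1 p.2.2) := by
    funext p
    simp only [Pi.add_apply, Finset.sum_apply]
    congr 1
    refine Finset.sum_congr rfl fun i _ => ?_
    split_ifs
    · rfl
    · simp [hx, hy, hz]
  have eR : (fun p : Pt n => ((∑ a, p.1 a ^ 2) + (∑ a, p.2.2 a ^ 2)) / 2
          - (1 / 100 : ℝ) * (∑ i ∈ Finset.univ.filter (fun i : Fin n => r ≤ (i : ℕ)),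
              ((∑ a, u i a * p.1 a) ^ 2 + (∑ a, w i a * p.2.2 a) ^ 2))
          - (1 / 100 : ℝ) * (∑ i : Fin n, ∑ j ∈ Finset.univ.erase i,
              (∑ a, v i a * p.2.1 a) ^ 2 *
                ((∑ a, u j a * p.1 a) ^ 2 + (∑ a, w j a * p.2.2 a) ^ 2))) =
      (1 / 2 : ℝ) • (∑ i, (x i ^ 2 + z i ^ 2))
        - (1 / 100 : ℝ) • (∑ i : Fin n, if r ≤ (i : ℕ) then (x i ^ 2 + z i ^ 2) else 0)
        - (1 / 100 : ℝ) • (∑ i, y i ^ 2 * (A + B - (x i ^ 2 + z i ^ 2))) := by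
    rw [Finset.sum_congr rfl fun i _ => ea i, ← hH, ← Finset.sum_filter]
    funext p
    simp only [Pi.sub_apply, Pi.smul_apply, smul_eq_mul, Finset.sum_apply, Pi.add_apply,
      Pi.mul_apply, Pi.pow_apply, hA, hB, hx, hy, hz]
    ring
  rw [eL, eR]
  simp only [map_add, map_sub, map_smul, map_sum, smul_eq_mul]
  have i1 : ∀ i : Fin n, EE μ (if r ≤ (i : ℕ) then 0 else x i * y i * z i) =
      if r ≤ (i : ℕ) then 0 else EE μ (x i * y i * z i) := fun i => by split_ifs <;> simp
  have i2 : ∀ i : Fin n, EE μ (if r ≤ (i : ℕ) then (x i ^ 2 + z i ^ 2) else 0) =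
      if r ≤ (i : ℕ) then EE μ (x i ^ 2 + z i ^ 2) else 0 := fun i => by split_ifs <;> simp
  simp only [i1, i2]
  simp only [map_add] at key ⊢
  linarith

theorem stmt_4 (n r : ℕ) (hr : r ≤ n)
    (u v w : Fin n → Fin n → ℝ)
    (hu : ∀ i j, (∑ a, u i a * u j a) = if i = j then (1 : ℝ) else 0)
    (hv : ∀ i j, (∑ a, v i a * v j a) = if i = j then (1 : ℝ) else 0)
    (hw : ∀ i j, (∑ a, w i a * w j a) = if i = j then (1 : ℝ) else 0)
    (Ω : Finset (Fin n × Fin n × Fin n))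
    (T : Fin n → Fin n → Fin n → ℝ)
    (hcert : IsHigherCert n r hr u v w Ω T)
    (μ : Pt n →₀ ℝ) (hμ : IsPseudoDist 6 μ) (hμy : SatisfiesYUnit 6 μ) :
    pE μ (fun x y z => ∑ a, ∑ b, ∑ c, T a b c * x a * y b * z c) ≤
      pE μ (fun x y z =>
        ((∑ a, x a ^ 2) + (∑ a, z a ^ 2)) / 2
          - (1 / 100 : ℝ) * (∑ i ∈ Finset.univ.filter (fun i : Fin n => r ≤ (i : ℕ)),
              ((∑ a, u i a * x a) ^ 2 + (∑ a, w i a * z a) ^ 2))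
          - (1 / 100 : ℝ) * (∑ i : Fin n, ∑ j ∈ Finset.univ.erase i,
              (∑ a, v i a * y a) ^ 2 *
                ((∑ a, u j a * x a) ^ 2 + (∑ a, w j a * z a) ^ 2))) := by
  obtain ⟨-, -, hc1, hc2, hc3, hs1, -, hs3⟩ := hcert
  obtain ⟨S, hS⟩ : ∃ S : Fin n → Fin n → Fin n → ℝ, S = fun a b c => T a b c - ∑ i : Fin r,
      u (Fin.castLE hr i) a * v (Fin.castLE hr i) b * w (Fin.castLE hr i) c := ⟨_, rfl⟩
  have hST : ∀ x y z, TF S x y z = TF T x y z - ∑ i : Fin r,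
      (∑ a, u (Fin.castLE hr i) a * x a) * (∑ b, v (Fin.castLE hr i) b * y b) *
        (∑ c, w (Fin.castLE hr i) c * z c) := by
    intro x y z
    rw [hS, TF_sub, TF_rank]
  have hinj : ∀ i j : Fin r, Fin.castLE hr i = Fin.castLE hr j ↔ i = j :=
    fun i j => (Fin.castLE_injective hr).eq_iff
  have hcast : ∀ i : Fin n, ¬ r ≤ (i : ℕ) → ∃ k : Fin r, i = Fin.castLE hr k :=
    fun i hi => ⟨⟨i, by omega⟩, by ext; simp⟩
  have hQdeg : ∀ X Y Z : Fin n → MvPolynomial (Fin n ⊕ Fin n ⊕ Fin n) ℝ,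
      (∀ i, (X i).totalDegree ≤ 1) → (∀ i, (Y i).totalDegree ≤ 1) →
      (∀ i, (Z i).totalDegree ≤ 1) →
      ((∑ i, X i ^ 2) + (∑ i, Y i ^ 2) * (∑ i, Z i ^ 2) -
      C (1000000 : ℝ) * (∑ a, ∑ b, ∑ c, C (T a b c - ∑ i : Fin r,
          u (Fin.castLE hr i) a * v (Fin.castLE hr i) b * w (Fin.castLE hr i) c) *
        XVar a * YVar b * ZVar c)).totalDegree ≤ 4 := by
    intro X Y Z hX hY hZ
    have d2 : ∀ W : Fin n → MvPolynomial (Fin n ⊕ Fin n ⊕ Fin n) ℝ,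
        (∀ i, (W i).totalDegree ≤ 1) → (∑ i, W i ^ 2).totalDegree ≤ 2 := by
      intro W hW
      refine totalDegree_finsetSum_le fun i _ => ?_
      refine (totalDegree_pow _ _).trans ?_
      have := hW i
      omega
    refine (totalDegree_sub _ _).trans (max_le ?_ ?_)
    · refine (totalDegree_add _ _).trans (max_le ((d2 X hX).trans (by norm_num)) ?_)
      refine (totalDegree_mul _ _).trans ?_
      have := d2 Y hY
      have := d2 Z hZ
      omega
    · refine (totalDegree_mul _ _).trans ?_
      rw [totalDegree_C, zero_add]
      refine totalDegree_finsetSum_le fun a _ => totalDegree_finsetSum_le fun b _ =>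
        totalDegree_finsetSum_le fun c _ => ?_
      refine (totalDegree_mul _ _).trans ?_
      refine (add_le_add_left (totalDegree_mul _ _) _).trans ?_
      refine (add_le_add_left (add_le_add_left (totalDegree_mul _ _) _) _).trans ?_
      simp only [totalDegree_C, totalDegree_X]
      norm_num
  have hX1 : ∀ i : Fin n, (XVar i).totalDegree ≤ 1 := fun i => by simp
  have hY1 : ∀ i : Fin n, (YVar i).totalDegree ≤ 1 := fun i => by simp
  have hZ1 : ∀ i : Fin n, (ZVar i).totalDegree ≤ 1 := fun i => by simp
  have main := core (r := r) u v w hu hv hw S ?_ ?_ ?_ μ hμ hμy ?_ ?_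
  · refine le_trans (le_of_eq ?_) main
    change EE μ (fun p => TF T p.1 p.2.1 p.2.2) = _
    congr 1
    funext p
    rw [hST, ← sum_castLE hr (fun i => (∑ a, u i a * p.1 a) * (∑ a, v i a * p.2.1 a) *
      (∑ a, w i a * p.2.2 a))]
    ring
  · intro i hi z
    obtain ⟨k, rfl⟩ := hcast i hi
    rw [hST, TF_rot1]
    simp [hc1, hu, hv, hinj]
  · intro i hi y
    obtain ⟨k, rfl⟩ := hcast i hi
    rw [hST, TF_rot2]
    simp [hc2, hu, hw, hinj]
  · intro i hi x
    obtain ⟨k, rfl⟩ := hcast i hi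
    rw [hST, TF_rot3]
    simp [hc3, hv, hw, hinj]
  · intro ℓ hℓ x y z hx hy hz
    have := EE_sos hμ _ hs1 (hQdeg _ _ _ hX1 hY1 hZ1) ℓ hℓ x y z hx hy hz
    simp only [map_sub, map_add, map_mul, map_sum, map_pow, eval_C, eval_X, Sum.elim_inl,
      Sum.elim_inr] at this
    rw [hS]
    exact this
  · intro ℓ hℓ x y z hx hy hz
    have := EE_sos hμ _ hs3 (hQdeg _ _ _ hZ1 hX1 hY1) ℓ hℓ x y z hx hy hz
    simp only [map_sub, map_add, map_mul, map_sum, map_pow, eval_C, eval_X, Sum.elim_inl,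
      Sum.elim_inr] at this
    rw [hS]
    exact this

end
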